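/- arXiv:2405.05757 — 5 statements merged into one kernel-verified Lean document; each statement's English description precedes it below -/
import Mathlib

section
/- Let $C_L \geq 1$, $W \geq 1$, and $S \geq 1$ be natural numbers. Then the following are equivalent: (i) for every $n$ with $1 \leq n \leq C_L$ there exist natural numbers $c, m$ with $n + c \cdot C_L = W + m \cdot (W+S)$; (ii) $\gcd(C_L, W+S) = 1$. -/
/-- Two arithmetic progressions with coprime positive common differences share a term. -/
theorem exists_add_mul_eq_add_mul_of_coprime {a b k l : ℕ} (hk : 0 < k) (hl : 0 < l)
    (h : Nat.Coprime k l) : ∃ c m : ℕ, a + c * k = b + m * l := by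
  obtain ⟨x, hxa, hxb⟩ := Nat.chineseRemainder h a b
  have hkl : 1 ≤ k * l := Nat.mul_pos hk hl
  have hle : a + b ≤ x + k * l * (a + b) := by nlinarith
  have ha : a ≡ x + k * l * (a + b) [MOD k] := by
    simpa [Nat.ModEq, mul_assoc] using hxa.symm
  have hb : b ≡ x + k * l * (a + b) [MOD l] := by
    simpa [Nat.ModEq, mul_assoc, mul_left_comm k l] using hxb.symm
  obtain ⟨c, hc⟩ := (Nat.modEq_iff_dvd' (by omega)).1 ha
  obtain ⟨m, hm⟩ := (Nat.modEq_iff_dvd' (by omega)).1 hb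
  refine ⟨c, m, ?_⟩
  rw [mul_comm c, mul_comm m, ← hc, ← hm]
  omega

/-- If progressions with difference `k` starting at `a` and at `a + 1` both meet a progression
with difference `l`, then `k` and `l` are coprime. -/
theorem coprime_of_add_mul_eq_add_mul {a b k l c m c' m' : ℕ}
    (h : a + c * k = b + m * l) (h' : a + 1 + c' * k = b + m' * l) : Nat.Coprime k l := by
  rw [← Nat.isCoprime_iff_coprime]
  refine ⟨c - c', m' - m, ?_⟩
  zify at h h'
  linear_combination h - h'

/-- Lemmas 1 and 4 combined: every arrival slot `n ∈ {1, …, C_L}` is eventually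
received (there exist `c, m` with `n + c * C_L = W + m * (W + S)`) if and only if
the duty-cycle length `C_L` and the wakeup–sleep cycle length `W + S` are coprime. -/
theorem stmt_1 (C_L W S : ℕ) (hC : 1 ≤ C_L) (hW : 1 ≤ W) (hS : 1 ≤ S) :
    (∀ n, 1 ≤ n → n ≤ C_L → ∃ c m : ℕ, n + c * C_L = W + m * (W + S)) ↔
      Nat.gcd C_L (W + S) = 1 := by
  constructor
  · intro h
    obtain rfl | hC' := hC.eq_or_lt
    · exact Nat.gcd_one_left _
    · obtain ⟨c, m, h₁⟩ := h 1 le_rfl hC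
      obtain ⟨c', m', h₂⟩ := h 2 one_le_two hC'
      exact coprime_of_add_mul_eq_add_mul h₁ h₂
  · intro h n _ _
    exact exists_add_mul_eq_add_mul_of_coprime hC (by omega) h
end

section
/- Let $C_L$ and $S$ be natural numbers with $C_L > S \geq 1$ and $\gcd(C_L, S+1) = 1$. Then for the arrival slot $n = C_L - S$: (i) the least natural number $c$ such that $(S+1)$ divides $n + c \cdot C_L - 1$ is $c = S$; and (ii) the corresponding number of wakeup–sleep cycles is $\frac{(C_L - S) + S \cdot C_L - 1}{S+1} = C_L - 1$. -/
/-- Lemma 2: with wakeup length `W = 1`, sleep length `S`, duty-cycle length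
`C_L > S` and `gcd(C_L, S+1) = 1`, the arrival slot `n = C_L - S` has
(i) least number of duty cycles `c = S` (least `c` with `(S+1) ∣ n + c * C_L - 1`),
and (ii) number of wakeup–sleep cycles `((C_L - S) + S * C_L - 1) / (S + 1) = C_L - 1`. -/
theorem stmt_5 (C_L S : ℕ) (hS : 1 ≤ S) (hCS : S < C_L)
    (hgcd : Nat.gcd C_L (S + 1) = 1) :
    IsLeast {c : ℕ | (S + 1) ∣ ((C_L - S) + c * C_L - 1)} S ∧
      ((C_L - S) + S * C_L - 1) / (S + 1) = C_L - 1 := by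
  obtain ⟨k, rfl⟩ := Nat.exists_eq_add_of_le (Nat.succ_le_of_lt hCS)
  have slot (c : ℕ) : (S.succ + k - S) + c * (S.succ + k) - 1 = k + c * (S + 1 + k) := by
    rw [Nat.succ_eq_add_one]
    omega
  have value : k + S * (S + 1 + k) = (S + 1) * (S + k) := by ring
  refine ⟨⟨?_, fun c hc => ?_⟩, ?_⟩
  · rw [Set.mem_ofPred_eq, slot, value]
    exact Dvd.intro _ rfl
  · rw [Set.mem_ofPred_eq, slot] at hc
    have hdvd : S + 1 ∣ (c + 1) * (S + 1 + k) := by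
      have h := dvd_add hc (dvd_refl (S + 1))
      rwa [show k + c * (S + 1 + k) + (S + 1) = (c + 1) * (S + 1 + k) by ring] at h
    have hle := Nat.le_of_dvd c.succ_pos
      ((Nat.Coprime.symm hgcd).dvd_of_dvd_mul_right hdvd)
    omega
  · rw [slot, value, Nat.mul_div_cancel_left _ S.succ_pos]
    omega
end

section
/- Let $C_L$ and $S$ be natural numbers with $C_L > S \geq 1$ and $\gcd(C_L, S+1) = 1$. For each $n$ with $1 \leq n \leq C_L$, let $c_{\min}(n)$ denote the least natural number $c$ such that $(S+1)$ divides $n + c \cdot C_L - 1$. Then for every $n$ with $1 \leq n \leq C_L$ and $n \neq C_L - S$, it holds that $n + c_{\min}(n) \cdot C_L < (C_L - S) + S \cdot C_L$. -/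
/-- `cMin C_L S n` is the least number of duty cycles `c` such that a sensor arriving
at slot `n` (with duty-cycle length `C_L`, wakeup length `1`, sleep length `S`) is
received, i.e. the least `c` with `(S+1) ∣ n + c * C_L - 1`. -/
noncomputable def cMin (C_L S n : ℕ) : ℕ := sInf {c : ℕ | (S + 1) ∣ (n + c * C_L - 1)}

/-- If `a` is coprime to `S + 1`, some `c ≤ S` solves `b + c * a ≡ 0` modulo `S + 1`. -/
theorem exists_le_dvd_add_mul {a S : ℕ} (hS : 1 ≤ S) (h : Nat.Coprime a (S + 1)) (b : ℕ) :
    ∃ c ≤ S, (S + 1) ∣ b + c * a := by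
  obtain ⟨m, -, hm⟩ := Nat.exists_mul_mod_eq_one_of_coprime h (by omega)
  have hm' : a * m ≡ 1 [MOD S + 1] := by
    rw [Nat.ModEq, hm, Nat.mod_eq_of_lt (by omega)]
  refine ⟨m * b * S % (S + 1), Nat.lt_succ_iff.mp (Nat.mod_lt _ S.succ_pos), ?_⟩
  rw [← Nat.modEq_zero_iff_dvd]
  calc b + m * b * S % (S + 1) * a
      ≡ b + m * b * S * a [MOD S + 1] := ((Nat.mod_modEq _ _).mul_right _).add_left _
    _ = b + a * m * (b * S) := by ring
    _ ≡ b + 1 * (b * S) [MOD S + 1] := (hm'.mul_right _).add_left _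
    _ = (S + 1) * b := by ring
    _ ≡ 0 [MOD S + 1] := Nat.modEq_zero_iff_dvd.mpr (dvd_mul_right _ _)

/-- Lemma 3: the worst (latest) reception slot among arrival slots `n ∈ {1, …, C_L}`
is incurred uniquely by `n = C_L - S`: every other arrival slot is received strictly
before slot `(C_L - S) + S * C_L`. -/
theorem stmt_6 (C_L S : ℕ) (hS : 1 ≤ S) (hCS : S < C_L)
    (hgcd : Nat.gcd C_L (S + 1) = 1) :
    ∀ n, 1 ≤ n → n ≤ C_L → n ≠ C_L - S →
      n + cMin C_L S n * C_L < (C_L - S) + S * C_L := by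
  intro n hn hnC hne
  obtain ⟨c, hcS, hc⟩ := exists_le_dvd_add_mul hS hgcd (n - 1)
  have hmem : c ∈ {c : ℕ | (S + 1) ∣ (n + c * C_L - 1)} := by
    rwa [Set.mem_ofPred_eq, Nat.sub_add_comm hn]
  have hle : cMin C_L S n ≤ S := (Nat.sInf_le hmem).trans hcS
  have hdvd : (S + 1) ∣ (n + cMin C_L S n * C_L - 1) := Nat.sInf_mem ⟨c, hmem⟩
  rcases hle.lt_or_eq with hlt | heq
  · have : (cMin C_L S n + 1) * C_L ≤ S * C_L := Nat.mul_le_mul_right _ hlt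
    rw [add_one_mul] at this
    omega
  · rw [heq] at hdvd ⊢
    have hdvd' : (S + 1) ∣ C_L + 1 - n := by
      have hsum : (n + S * C_L - 1) + (C_L + 1 - n) = (S + 1) * C_L := by
        rw [add_one_mul]
        omega
      exact (Nat.dvd_add_right hdvd).mp (hsum ▸ dvd_mul_right _ _)
    have := Nat.le_of_dvd (by omega) hdvd'
    omega
end

section
/- Let $C_L$ and $S$ be natural numbers with $C_L > S \geq 1$ and $\gcd(C_L, S+1) = 1$. For each $n$ with $1 \leq n \leq C_L$, let $c_{\min}(n)$ denote the least natural number $c$ such that $(S+1)$ divides $n + c \cdot C_L - 1$. Then $\max_{1 \leq n \leq C_L} \left( n + c_{\min}(n) \cdot C_L \right) = C_L \cdot (S+1) - S$, and this maximum is attained at $n = C_L - S$. -/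
theorem exists_le_dvd_add_mul_sub_one {a S n : ℕ} (hS : 1 ≤ S) (h : Nat.Coprime a (S + 1))
    (hn : 1 ≤ n) : ∃ c ≤ S, S + 1 ∣ n + c * a - 1 := by
  obtain ⟨m, -, hm⟩ := Nat.exists_mul_mod_eq_one_of_coprime h (by omega)
  refine ⟨m * ((n - 1) * S) % (S + 1), Nat.lt_succ_iff.mp (Nat.mod_lt _ (by omega)), ?_⟩
  rw [Nat.sub_add_comm hn, ← Nat.modEq_zero_iff_dvd]
  have hm' : a * m ≡ 1 [MOD S + 1] := by
    rw [Nat.ModEq, hm, Nat.mod_eq_of_lt (by omega)]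
  calc n - 1 + m * ((n - 1) * S) % (S + 1) * a
      ≡ n - 1 + m * ((n - 1) * S) * a [MOD S + 1] :=
        ((Nat.mod_modEq _ _).mul_right a).add_left _
    _ = n - 1 + a * m * ((n - 1) * S) := by ring
    _ ≡ n - 1 + 1 * ((n - 1) * S) [MOD S + 1] := (hm'.mul_right _).add_left _
    _ = (n - 1) * (S + 1) := by ring
    _ ≡ 0 [MOD S + 1] := Nat.modEq_zero_iff_dvd.mpr (dvd_mul_left _ _)

theorem cMin_le_and_dvd {C_L S n : ℕ} (hS : 1 ≤ S) (h : Nat.Coprime C_L (S + 1)) (hn : 1 ≤ n) :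
    cMin C_L S n ≤ S ∧ S + 1 ∣ n + cMin C_L S n * C_L - 1 := by
  obtain ⟨c, hc, hd⟩ := exists_le_dvd_add_mul_sub_one hS h hn
  exact ⟨(Nat.sInf_le hd).trans hc,
    Nat.sInf_mem (s := {c : ℕ | S + 1 ∣ n + c * C_L - 1}) ⟨c, hd⟩⟩

theorem cMin_sub_eq {C_L S : ℕ} (hS : 1 ≤ S) (hCS : S < C_L) (h : Nat.Coprime C_L (S + 1)) :
    cMin C_L S (C_L - S) = S := by
  obtain ⟨hle, hd⟩ := cMin_le_and_dvd (n := C_L - S) hS h (by omega)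
  have hdvd : S + 1 ∣ (cMin C_L S (C_L - S) + 1) * C_L := by
    have heq : (cMin C_L S (C_L - S) + 1) * C_L =
        C_L - S + cMin C_L S (C_L - S) * C_L - 1 + (S + 1) := by
      rw [add_mul, one_mul]
      omega
    rw [heq]
    exact dvd_add hd dvd_rfl
  have := Nat.le_of_dvd (Nat.succ_pos _) (h.symm.dvd_of_dvd_mul_right hdvd)
  omega

/-- Theorem 1 together with Lemma 5: the maximum of the reception slot
`n + cMin(n) * C_L` over all arrival slots `n ∈ {1, …, C_L}` equals
`C_L * (S + 1) - S`, and it is attained at `n = C_L - S`. -/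
theorem stmt_7 (C_L S : ℕ) (hS : 1 ≤ S) (hCS : S < C_L)
    (hgcd : Nat.gcd C_L (S + 1) = 1) :
    IsGreatest {d : ℕ | ∃ n, 1 ≤ n ∧ n ≤ C_L ∧ d = n + cMin C_L S n * C_L}
        (C_L * (S + 1) - S) ∧
      (C_L - S) + cMin C_L S (C_L - S) * C_L = C_L * (S + 1) - S := by
  have heq : C_L - S + cMin C_L S (C_L - S) * C_L = C_L * (S + 1) - S := by
    rw [cMin_sub_eq hS hCS hgcd, mul_add, mul_one, mul_comm S]
    omega
  refine ⟨⟨⟨C_L - S, by omega, by omega, heq.symm⟩, ?_⟩, heq⟩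
  rintro d ⟨n, hn, hnC, rfl⟩
  obtain ⟨hle, k, hk⟩ := cMin_le_and_dvd hS hgcd hn
  have hmul : cMin C_L S n * C_L ≤ S * C_L := Nat.mul_le_mul_right _ hle
  have hlt : (S + 1) * k < (S + 1) * C_L := by
    rw [add_mul S 1 C_L]
    omega
  have hk' : (S + 1) * (k + 1) ≤ (S + 1) * C_L :=
    Nat.mul_le_mul_left _ (lt_of_mul_lt_mul_left hlt (Nat.zero_le _))
  rw [mul_add, mul_one] at hk'
  rw [mul_comm C_L]
  omega
end

section
/- Let $C_L \geq 1$, $W \geq 1$, and $S \geq 1$ be natural numbers with $\gcd(C_L, W+S) > 1$. Then there exists an $n$ with $1 \leq n \leq C_L$ such that for all natural numbers $c, m$, it holds that $n + c \cdot C_L \neq W + m \cdot (W+S)$. -/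
/-- Lemma 4: if the duty-cycle length `C_L` and the wakeup–sleep cycle length
`W + S` are not coprime, then some arrival slot `n ∈ {1, …, C_L}` is never
received: for all `c, m`, `n + c * C_L ≠ W + m * (W + S)`. -/
theorem stmt_9 (C_L W S : ℕ) (hC : 1 ≤ C_L) (hW : 1 ≤ W) (hS : 1 ≤ S)
    (hgcd : 1 < Nat.gcd C_L (W + S)) :
    ∃ n, 1 ≤ n ∧ n ≤ C_L ∧ ∀ c m : ℕ, n + c * C_L ≠ W + m * (W + S) := by
  have hdC : Nat.gcd C_L (W + S) ∣ C_L := Nat.gcd_dvd_left _ _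
  have hdP : Nat.gcd C_L (W + S) ∣ W + S := Nat.gcd_dvd_right _ _
  by_cases hdW : Nat.gcd C_L (W + S) ∣ W
  · refine ⟨1, le_rfl, hC, fun c m h => ?_⟩
    have hd : Nat.gcd C_L (W + S) ∣ 1 + c * C_L :=
      h ▸ dvd_add hdW (hdP.mul_left m)
    have hd_one := (Nat.dvd_add_left (hdC.mul_left c)).mp hd
    exact hgcd.ne' (Nat.dvd_one.mp hd_one)
  · refine ⟨C_L, hC, le_rfl, fun c m h => hdW ?_⟩
    have hd : Nat.gcd C_L (W + S) ∣ W + m * (W + S) :=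
      h ▸ dvd_add hdC (hdC.mul_left c)
    exact (Nat.dvd_add_left (hdP.mul_left m)).mp hd
end
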